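/- arXiv:1112.3193 — 2 statements merged into one kernel-verified Lean document; each statement's English description precedes it below -/
import Mathlib

section
/- Let T be a tree and x an eigenvector of T for eigenvalue λ. Then every connected component of the induced subgraph T[supp(x)] is also a connected component of the induced subgraph T[V(T) \ N_λ(T)]; that is, the vertex set of each connected component of T[supp(x)] equals the vertex set of some connected component of T[V(T) \ N_λ(T)]. -/
open SimpleGraph

open scoped Classical

/-- The real adjacency matrix of a simple graph. -/
noncomputable def adjMat {V : Type*} (G : SimpleGraph V) : Matrix V V ℝ :=
  fun u v => if G.Adj u v then 1 else 0

/-- The eigenspace `{x : A x = μ x}` of the adjacency matrix of `G`. -/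
noncomputable def eigSpace {V : Type*} [Fintype V] (G : SimpleGraph V) (μ : ℝ) :
    Submodule ℝ (V → ℝ) :=
  LinearMap.ker ((adjMat G).mulVecLin - μ • LinearMap.id)

/-- `x` is an eigenvector of `G` for eigenvalue `μ`. -/
def IsEigenvector {V : Type*} [Fintype V] (G : SimpleGraph V) (μ : ℝ) (x : V → ℝ) : Prop :=
  x ≠ 0 ∧ (adjMat G).mulVec x = μ • x

/-- `N_μ(G)`: vertices on which every eigenvector of `G` for `μ` vanishes. -/
def nSet {V : Type*} [Fintype V] (G : SimpleGraph V) (μ : ℝ) : Set V :=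
  {v | ∀ x : V → ℝ, IsEigenvector G μ x → x v = 0}

/-- `N^C_μ(G)`: vertices of `N_μ(G)` with a neighbor outside `N_μ(G)`. -/
def ncSet {V : Type*} [Fintype V] (G : SimpleGraph V) (μ : ℝ) : Set V :=
  {v | v ∈ nSet G μ ∧ ∃ w, G.Adj v w ∧ w ∉ nSet G μ}

/-- `C` is the vertex set of a connected component of the induced subgraph `G[S]`. -/
def IsCompOf {V : Type*} (G : SimpleGraph V) (S C : Set V) : Prop :=
  ∃ c : (G.induce S).ConnectedComponent, C = Subtype.val '' c.supp

/-- An antisymmetric conserved flow supported on the edges of an acyclic graph is zero. -/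
theorem flow_eq_zero_of_isAcyclic {V : Type*} [Fintype V] {G : SimpleGraph V}
    (hG : G.IsAcyclic) (g : V → V → ℝ) (hanti : ∀ a b, g a b = -g b a)
    (hsupp : ∀ a b, ¬ G.Adj a b → g a b = 0) (hcons : ∀ a, ∑ b, g a b = 0) (v w : V) :
    g v w = 0 := by
  by_cases hvw : G.Adj v w
  swap
  · exact hsupp v w hvw
  set H := G.deleteEdges {s(v, w)} with hH
  have hw : ¬ H.Reachable v w :=
    isBridge_iff.1 (isAcyclic_iff_forall_adj_isBridge.1 hG hvw)
  set S : Finset V := Finset.univ.filter fun a => H.Reachable v a with hS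
  have hmem : ∀ a, a ∈ S ↔ H.Reachable v a := by simp [hS]
  have hinner : ∑ a ∈ S, ∑ b ∈ S, g a b = 0 := by
    have h : ∑ a ∈ S, ∑ b ∈ S, g a b = -∑ a ∈ S, ∑ b ∈ S, g a b := by
      conv_lhs => rw [Finset.sum_comm]
      simp only [← Finset.sum_neg_distrib]
      exact Finset.sum_congr rfl fun a _ => Finset.sum_congr rfl fun b _ => hanti b a
    linarith
  have hcross : ∀ a ∈ S, ∀ b ∈ Sᶜ, ¬ (a = v ∧ b = w) → g a b = 0 := by
    intro a ha b hb hne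
    rw [Finset.mem_compl, hmem] at hb
    rw [hmem] at ha
    refine hsupp a b fun hab => hb (ha.trans (Adj.reachable ?_))
    rw [hH, deleteEdges_adj]
    refine ⟨hab, fun h => ?_⟩
    rcases Sym2.eq_iff.1 (Set.mem_singleton_iff.1 h) with h | ⟨rfl, rfl⟩
    · exact hne h
    · exact hw ha
  have houter : ∑ a ∈ S, ∑ b ∈ Sᶜ, g a b = g v w := by
    rw [Finset.sum_eq_single_of_mem v ((hmem v).2 (Reachable.refl v)),
      Finset.sum_eq_single_of_mem w (by rwa [Finset.mem_compl, hmem])]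
    · intro b hb hbw
      exact hcross v ((hmem v).2 (Reachable.refl v)) b hb fun h => hbw h.2
    · intro a ha hav
      exact Finset.sum_eq_zero fun b hb => hcross a ha b hb fun h => hav h.1
  have htotal : ∑ a ∈ S, (∑ b ∈ S, g a b + ∑ b ∈ Sᶜ, g a b) = 0 :=
    Finset.sum_eq_zero fun a _ => by rw [Finset.sum_add_sum_compl, hcons]
  rw [Finset.sum_add_distrib, hinner, houter, zero_add] at htotal
  exact htotal

/-- On an edge of an acyclic graph, two solutions of the eigenvalue equation for the same
eigenvalue are proportional. -/
theorem mul_eq_mul_of_adj {V : Type*} [Fintype V] {G : SimpleGraph V} (hG : G.IsAcyclic)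
    {μ : ℝ} {x y : V → ℝ} (hx : (adjMat G).mulVec x = μ • x)
    (hy : (adjMat G).mulVec y = μ • y) {v w : V} (hvw : G.Adj v w) :
    x v * y w = x w * y v := by
  have h := flow_eq_zero_of_isAcyclic hG (fun a b => adjMat G a b * (x a * y b - x b * y a))
    (fun a b => by simp only [adjMat, G.adj_comm a b]; ring)
    (fun a b hab => by simp [adjMat, hab])
    (fun a => by
      have h1 : ∑ b, adjMat G a b * x b = μ * x a := congrFun hx a
      have h2 : ∑ b, adjMat G a b * y b = μ * y a := congrFun hy a
      calc ∑ b, adjMat G a b * (x a * y b - x b * y a)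
          = x a * ∑ b, adjMat G a b * y b - y a * ∑ b, adjMat G a b * x b := by
            rw [Finset.mul_sum, Finset.mul_sum, ← Finset.sum_sub_distrib]
            exact Finset.sum_congr rfl fun b _ => by ring
        _ = 0 := by rw [h1, h2]; ring) v w
  simp only [adjMat, if_pos hvw, one_mul] at h
  linarith

/-- If `S ⊆ S'` and no edge joins `S` to `S' \ S`, then components of `G[S]` are components
of `G[S']`. -/
theorem IsCompOf.of_subset {V : Type*} {G : SimpleGraph V} {S S' C : Set V} (hSS' : S ⊆ S')
    (hclosed : ∀ v ∈ S, ∀ w ∈ S', G.Adj v w → w ∈ S) (hC : IsCompOf G S C) :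
    IsCompOf G S' C := by
  obtain ⟨c, rfl⟩ := hC
  induction c using ConnectedComponent.ind with | _ r => ?_
  have hwalk : ∀ {a b : S'}, (G.induce S').Walk a b → ∀ ha : a.1 ∈ S,
      ∃ hb : b.1 ∈ S, (G.induce S).Reachable ⟨a, ha⟩ ⟨b, hb⟩ := by
    intro a b p
    induction p with
    | nil => exact fun ha => ⟨ha, Reachable.refl _⟩
    | @cons a d b had _ ih =>
      intro ha
      have hd : d.1 ∈ S := hclosed a ha d d.2 had
      obtain ⟨hb, hr⟩ := ih hd
      have had' : (G.induce S).Adj ⟨a, ha⟩ ⟨d, hd⟩ := had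
      exact ⟨hb, had'.reachable.trans hr⟩
  refine ⟨(G.induce S').connectedComponentMk ⟨r, hSS' r.2⟩, Set.ext fun z => ⟨?_, ?_⟩⟩
  · rintro ⟨a, ha, rfl⟩
    refine ⟨⟨a, hSS' a.2⟩, ConnectedComponent.sound ?_, rfl⟩
    exact (ConnectedComponent.exact ha).map (G.induceHomOfLE hSS').toHom
  · rintro ⟨a, ha, rfl⟩
    obtain ⟨p⟩ := (ConnectedComponent.exact ha).symm
    obtain ⟨hb, hr⟩ := hwalk p r.2
    exact ⟨⟨a, hb⟩, ConnectedComponent.sound hr.symm, rfl⟩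

theorem stmt_3 {V : Type*} [Fintype V] (G : SimpleGraph V) (hT : G.IsTree) (μ : ℝ)
    (x : V → ℝ) (hx : IsEigenvector G μ x) (C : Set V)
    (hC : IsCompOf G {v | x v ≠ 0} C) :
    IsCompOf G ((nSet G μ)ᶜ) C := by
  refine IsCompOf.of_subset (S := {v | x v ≠ 0}) (fun v hv hvN => hv (hvN x hx))
    (fun v hv w hw hvw hxw => hw fun y hy => ?_) hC
  have h := mul_eq_mul_of_adj hT.isAcyclic hx.2 hy.2 hvw
  rw [hxw, zero_mul] at h
  exact (mul_eq_zero.1 h).resolve_left hv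
end

section
/- Let T be a tree and λ an eigenvalue of T. Then: (i) every connected component of T[V(T) \ N_λ(T)] is also a connected component of T[V(T) \ N^C_λ(T)]; and (ii) every connected component C of T[V(T) \ N^C_λ(T)] that is not a connected component of T[V(T) \ N_λ(T)] does not have λ as an eigenvalue, i.e., λ is not an eigenvalue of the adjacency matrix of the induced subgraph on C. -/
open SimpleGraph

open scoped Classical

/-- A connected component of `G[S]` is a nonempty subset of `S` that is closed under adjacency
within `S` and that satisfies induction along the edges of `G` inside it. -/
theorem isCompOf_iff {V : Type*} (G : SimpleGraph V) (S C : Set V) :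
    IsCompOf G S C ↔ C ⊆ S ∧ C.Nonempty ∧ (∀ a ∈ C, ∀ b ∈ S, G.Adj a b → b ∈ C) ∧
      ∀ P : Set V, (C ∩ P).Nonempty →
        (∀ u ∈ C, ∀ v ∈ C, G.Adj u v → u ∈ P → v ∈ P) → C ⊆ P := by
  constructor
  · rintro ⟨c, rfl⟩
    have closed : ∀ a b : S, (G.induce S).Adj a b → a ∈ c.supp → b ∈ c.supp := by
      intro a b hab ha
      rw [ConnectedComponent.mem_supp_iff] at ha ⊢
      rw [← ha]
      exact (ConnectedComponent.sound hab.reachable).symm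
    refine ⟨?_, c.nonempty_supp.image _, ?_, ?_⟩
    · rintro _ ⟨a, -, rfl⟩
      exact a.2
    · rintro _ ⟨a, ha, rfl⟩ b hb hab
      exact ⟨⟨b, hb⟩, closed a ⟨b, hb⟩ hab ha, rfl⟩
    · rintro P ⟨_, ⟨a, ha, rfl⟩, haP⟩ hP _ ⟨b, hb, rfl⟩
      obtain ⟨p⟩ := ConnectedComponent.exact (ha.trans hb.symm)
      induction p with
      | nil => exact haP
      | cons h p ih =>
        have hv := closed _ _ h ha
        exact ih hv (hP _ (Set.mem_image_of_mem _ ha) _ (Set.mem_image_of_mem _ hv) h haP) hb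
  · rintro ⟨hCS, ⟨a, ha⟩, hclosed, hind⟩
    refine ⟨(G.induce S).connectedComponentMk ⟨a, hCS ha⟩, Set.Subset.antisymm ?_ ?_⟩
    · refine hind _ ⟨a, ha, Set.mem_image_of_mem _
        (ConnectedComponent.connectedComponentMk_mem (v := (⟨a, hCS ha⟩ : S)))⟩ ?_
      rintro u - v hv huv ⟨u, hu, rfl⟩
      refine ⟨⟨v, hCS hv⟩, ?_, rfl⟩
      rw [ConnectedComponent.mem_supp_iff] at hu ⊢
      rw [← hu]
      have h : (G.induce S).Adj u ⟨v, hCS hv⟩ := huv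
      exact (ConnectedComponent.sound h.reachable).symm
    · rintro _ ⟨b, hb, rfl⟩
      obtain ⟨p⟩ := ConnectedComponent.exact hb.symm
      have key : ∀ {x y : S}, (G.induce S).Walk x y → x.1 ∈ C → y.1 ∈ C := by
        intro x y p
        induction p with
        | nil => exact id
        | cons h p ih => exact fun hx => ih (hclosed _ hx _ (Subtype.property _) h)
      exact key p ha

theorem adjMat_mulVec_apply {V : Type*} [Fintype V] (G : SimpleGraph V) (x : V → ℝ) (u : V) :
    (adjMat G).mulVec x u = ∑ v, if G.Adj u v then x v else 0 := by
  simp [Matrix.mulVec, dotProduct, adjMat]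

/-- If `x` is an eigenvector of an acyclic graph vanishing at `v` but not at a neighbor `w` of `v`,
then rescaling `x` on the branch at `v` containing `w` solves `(A - μ) f = e_v`. The support of `f`
misses every set that is connected, avoids `v` and `w`, and contains a neighbor of `v`. -/
theorem exists_solution_supported_on_branch {V : Type*} [Fintype V] {G : SimpleGraph V}
    (hG : G.IsAcyclic) {μ : ℝ} {x : V → ℝ} (hx : (adjMat G).mulVec x = μ • x) {v w : V}
    (hvw : G.Adj v w) (hv : x v = 0) (hw : x w ≠ 0) {C : Set V} (hvC : v ∉ C) (hwC : w ∉ C)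
    (hC : ∃ c ∈ C, G.Adj v c)
    (hind : ∀ P : Set V, (C ∩ P).Nonempty →
      (∀ a ∈ C, ∀ b ∈ C, G.Adj a b → a ∈ P → b ∈ P) → C ⊆ P) :
    ∃ f : V → ℝ, (adjMat G).mulVec f - μ • f = Pi.single v 1 ∧ ∀ c ∈ C, f c = 0 := by
  set H := G.deleteEdges {s(v, w)} with hH
  set B : Set V := {u | H.Reachable w u} with hB
  have hvB : v ∉ B := by
    have h := isAcyclic_iff_forall_adj_isBridge.1 hG hvw
    rw [isBridge_iff] at h
    exact fun h' => h h'.symm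
  have hwB : w ∈ B := Reachable.refl w
  have hexit : ∀ a b, G.Adj a b → a ∈ B → b ∉ B → a = w ∧ b = v := by
    intro a b hab ha hb
    by_cases he : s(a, b) = s(v, w)
    · rcases Sym2.eq_iff.1 he with ⟨rfl, rfl⟩ | h
      · exact absurd ha hvB
      · exact h
    · have h : H.Adj a b := by
        rw [hH, deleteEdges_adj]
        exact ⟨hab, he⟩
      exact absurd (ha.trans h.reachable) hb
  have hCB : ∀ c ∈ C, c ∉ B := by
    intro c hc hcB
    have hsub : C ⊆ B := by
      refine hind B ⟨c, hc, hcB⟩ fun a ha b hb hab haB => ?_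
      by_contra hbB
      exact hvC ((hexit a b hab haB hbB).2 ▸ hb)
    obtain ⟨d, hd, hvd⟩ := hC
    exact hwC ((hexit d v hvd.symm (hsub hd) hvB).1 ▸ hd)
  refine ⟨fun u => if u ∈ B then (x w)⁻¹ * x u else 0, ?_, fun c hc => if_neg (hCB c hc)⟩
  funext u
  simp only [Pi.sub_apply, Pi.smul_apply, smul_eq_mul, adjMat_mulVec_apply]
  by_cases hu : u ∈ B
  · have huv : u ≠ v := fun h => hvB (h ▸ hu)
    have hxu := congrFun hx u
    rw [adjMat_mulVec_apply, Pi.smul_apply, smul_eq_mul] at hxu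
    have hsum : (∑ b, if G.Adj u b then (if b ∈ B then (x w)⁻¹ * x b else 0) else 0)
        = (x w)⁻¹ * ∑ b, if G.Adj u b then x b else 0 := by
      rw [Finset.mul_sum]
      refine Finset.sum_congr rfl fun b _ => ?_
      by_cases hab : G.Adj u b
      · by_cases hb : b ∈ B
        · simp [hab, hb]
        · simp [(hexit u b hab hu hb).2, hv]
      · simp [hab]
    rw [hsum, hxu, if_pos hu, Pi.single_eq_of_ne huv]
    ring
  · rw [if_neg hu, mul_zero, sub_zero]
    by_cases huv : u = v
    · subst huv
      rw [Pi.single_eq_same, Finset.sum_eq_single w]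
      · simp [hvw, hwB, hw]
      · intro b _ hbw
        by_cases hab : G.Adj u b
        · have hb : b ∉ B := fun hb => hbw (hexit b u hab.symm hb hu).1
          simp [hb]
        · simp [hab]
      · simp
    · rw [Pi.single_eq_of_ne huv]
      refine Finset.sum_eq_zero fun b _ => ?_
      by_cases hab : G.Adj u b
      · have hb : b ∉ B := fun hb => huv (hexit b u hab.symm hb hu).2
        simp [hb]
      · simp [hab]

/-- Extension by zero of a vector on `C` does not change the adjacency product on `C`. -/
theorem adjMat_mulVec_extend_zero {V : Type*} [Fintype V] (G : SimpleGraph V) (C : Set V)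
    (y : ↥C → ℝ) (u : ↥C) :
    (adjMat G).mulVec (fun v => if h : v ∈ C then y ⟨v, h⟩ else 0) u =
      (adjMat (G.induce C)).mulVec y u := by
  rw [adjMat_mulVec_apply, adjMat_mulVec_apply]
  symm
  refine Fintype.sum_of_injective Subtype.val Subtype.val_injective _ _ ?_ ?_
  · intro v hv
    have hvC : v ∉ C := by simpa using hv
    simp [hvC]
  · intro v
    simp

theorem stmt_7 {V : Type*} [Fintype V] (G : SimpleGraph V) (hT : G.IsTree) (μ : ℝ)
    (hμ : ∃ x, IsEigenvector G μ x) :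
    (∀ C : Set V, IsCompOf G ((nSet G μ)ᶜ) C → IsCompOf G ((ncSet G μ)ᶜ) C) ∧
      (∀ C : Set V, IsCompOf G ((ncSet G μ)ᶜ) C → ¬IsCompOf G ((nSet G μ)ᶜ) C →
        ¬∃ y : ↥C → ℝ, IsEigenvector (G.induce C) μ y) := by
  have hsub : (nSet G μ)ᶜ ⊆ (ncSet G μ)ᶜ := fun v hv h => hv h.1
  constructor
  · intro C hC
    rw [isCompOf_iff] at hC ⊢
    obtain ⟨hCS, hne, hclosed, hind⟩ := hC
    refine ⟨hCS.trans hsub, hne, fun a ha b hb hab => hclosed a ha b (fun hbN => ?_) hab, hind⟩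
    exact hb ⟨hbN, a, hab.symm, hCS ha⟩
  · rintro C hC hC' ⟨y, hy0, hy⟩
    rw [isCompOf_iff] at hC hC'
    obtain ⟨hCS, hne, hclosed, hind⟩ := hC
    have hCN : C ⊆ nSet G μ := by
      intro c hc
      by_contra hcN
      refine hC' ⟨hind _ ⟨c, hc, hcN⟩ fun u _ v hv huv huN hvN => ?_, hne,
        fun a ha b hb hab => hclosed a ha b (hsub hb) hab, hind⟩
      exact hCS hv ⟨hvN, u, huv.symm, huN⟩
    set z : V → ℝ := fun v => if h : v ∈ C then y ⟨v, h⟩ else 0 with hz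
    set L : (V → ℝ) →ₗ[ℝ] (V → ℝ) := (adjMat G).mulVecLin - μ • LinearMap.id
    have hLapp : ∀ f, L f = (adjMat G).mulVec f - μ • f := fun f => rfl
    have hcorr : ∀ v, ∃ f : V → ℝ, L f = Pi.single v (L z v) ∧ ∀ c ∈ C, f c = 0 := by
      intro v
      by_cases hr : L z v = 0
      · exact ⟨0, by simp [hr], fun _ _ => rfl⟩
      have hvC : v ∉ C := by
        intro hvC
        apply hr
        have h1 := adjMat_mulVec_extend_zero G C y ⟨v, hvC⟩
        rw [hy] at h1
        rw [hLapp, Pi.sub_apply, hz, h1]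
        simp [hvC]
      have hadj : ∃ c ∈ C, G.Adj v c := by
        by_contra! hno
        apply hr
        rw [hLapp, Pi.sub_apply, adjMat_mulVec_apply, Finset.sum_eq_zero]
        · simp [hz, hvC]
        · intro b _
          by_cases hb : b ∈ C
          · simp [hno b hb]
          · simp [hz, hb]
      obtain ⟨c, hc, hvc⟩ := hadj
      have hvNC : v ∈ ncSet G μ := by
        by_contra h
        exact hvC (hclosed c hc v h hvc.symm)
      obtain ⟨hvN, w, hvw, hwN⟩ := hvNC
      have hwx : ∃ x, IsEigenvector G μ x ∧ x w ≠ 0 := by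
        simpa [nSet] using hwN
      obtain ⟨x, hx, hxw⟩ := hwx
      obtain ⟨f, hf, hfC⟩ := exists_solution_supported_on_branch hT.isAcyclic hx.2 hvw (hvN x hx)
        hxw hvC (fun h => hwN (hCN h)) ⟨c, hc, hvc⟩ hind
      refine ⟨L z v • f, ?_, fun c hc => by simp [hfC c hc]⟩
      rw [map_smul, hLapp f, hf, ← Pi.single_smul, smul_eq_mul, mul_one]
    choose f hf hfC using hcorr
    have hker : L (z - ∑ v, f v) = 0 := by
      rw [map_sub, map_sum, Finset.sum_congr rfl fun v _ => hf v, Finset.univ_sum_single, sub_self]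
    have hval : ∀ c : ↥C, (z - ∑ v, f v) c = y c := by
      intro c
      simp [hz, Finset.sum_apply, hfC _ c c.2]
    obtain ⟨c, hc⟩ := Function.ne_iff.1 hy0
    refine hc ((hval c).symm.trans (hCN c.2 _ ⟨fun h0 => hc ?_, ?_⟩))
    · rw [← hval c, h0]
      rfl
    · rw [hLapp, sub_eq_zero] at hker
      exact hker
end
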